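/- arXiv:2302.05909 — 4 statements merged into one kernel-verified Lean document; each statement's English description precedes it below -/
import Mathlib

section
/- All two-valued groups of the form X^a_A (A an abelian group) and X^u_V × W (V, W Boolean groups) are non-special. The two-valued groups Y_V × W are special whenever dim V ≥ 2. -/
/-!
Two-valued groups after V.M. Buchstaber, A.P. Veselov and A.A. Gaifullin.

`X.mul x y` is the two-element multiset `x * y`.
-/

universe u v w u' v' w'

/-- A two-valued group: a set with a multiplication valued in two-element multisets,
a strong identity `e`, and a (unique) inverse. -/
structure TwoValuedGroup (T : Type u) where
  mul : T → T → Multiset T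
  e : T
  inv : T → T
  card_mul : ∀ x y, Multiset.card (mul x y) = 2
  assoc : ∀ x y z, (mul x y).bind (fun t => mul t z) = (mul y z).bind (fun t => mul x t)
  e_mul : ∀ x, mul e x = {x, x}
  mul_e : ∀ x, mul x e = {x, x}
  e_mem_mul_inv : ∀ x, e ∈ mul x (inv x)
  e_mem_inv_mul : ∀ x, e ∈ mul (inv x) x
  inv_unique : ∀ x y, (e ∈ mul x y ∨ e ∈ mul y x) → y = inv x

namespace TwoValuedGroup

/-- Commutativity of a two-valued group. -/
def Commutative {T : Type u} (X : TwoValuedGroup T) : Prop := ∀ x y, X.mul x y = X.mul y x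

/-- Involutivity: every element is its own inverse. -/
def Involutive {T : Type u} (X : TwoValuedGroup T) : Prop := ∀ x, X.inv x = x

/-- A homomorphism of two-valued groups. -/
def IsHom {T : Type u} {S : Type v} (X : TwoValuedGroup T) (Z : TwoValuedGroup S)
    (f : T → S) : Prop :=
  f X.e = Z.e ∧ ∀ x y, (X.mul x y).map f = Z.mul (f x) (f y)

/-- Two two-valued groups are isomorphic if there is a bijective homomorphism. -/
def Isomorphic {T : Type u} {S : Type v} (X : TwoValuedGroup T) (Z : TwoValuedGroup S) : Prop :=
  ∃ f : T → S, Function.Bijective f ∧ IsHom X Z f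

/-- A subgroup of a two-valued group: a subset closed under multiplication. -/
def IsSubgroup {T : Type u} (X : TwoValuedGroup T) (Y : Set T) : Prop :=
  ∀ y₁ ∈ Y, ∀ y₂ ∈ Y, ∀ z ∈ X.mul y₁ y₂, z ∈ Y

/-- `S` generates `X` if the only subgroup of `X` containing `S` is all of `X`. -/
def Generates {T : Type u} (X : TwoValuedGroup T) (S : Set T) : Prop :=
  ∀ Y : Set T, X.IsSubgroup Y → S ⊆ Y → Y = Set.univ

/-- Finitely generated two-valued group. -/
def FinitelyGenerated {T : Type u} (X : TwoValuedGroup T) : Prop :=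
  ∃ S : Set T, S.Finite ∧ X.Generates S

/-- A family of integer power sequences: `P x k` is the `k`-th power `x^k` of `x`;
these are uniquely determined in an involutive two-valued group. -/
def IsPowFamily {T : Type u} (X : TwoValuedGroup T) (P : T → ℤ → T) : Prop :=
  ∀ x : T, P x 0 = X.e ∧ P x 1 = x ∧ (∀ k : ℤ, P x (-k) = P x k) ∧
    ∀ k : ℤ, 1 ≤ k → X.mul x (P x k) = {P x (k - 1), P x (k + 1)}

/-- The order of an element: the least positive `k` with `x^k = e`;
the value `0` encodes infinite order. -/
noncomputable def ordOf {T : Type u} (X : TwoValuedGroup T) (P : T → ℤ → T) (x : T) : ℕ :=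
  sInf {n : ℕ | 0 < n ∧ P x (n : ℤ) = X.e}

/-- `ord x > 2` (where infinite order counts as `> 2`). -/
def OrdGT2 {T : Type u} (X : TwoValuedGroup T) (P : T → ℤ → T) (x : T) : Prop :=
  X.ordOf P x = 0 ∨ 2 < X.ordOf P x

/-- A two-valued group is special if it contains a special pair: `ord x > 2`, `ord y > 2`,
and `x * y` consists of two equal elements. -/
def IsSpecial {T : Type u} (X : TwoValuedGroup T) (P : T → ℤ → T) : Prop :=
  ∃ x y z : T, X.OrdGT2 P x ∧ X.OrdGT2 P y ∧ X.mul x y = {z, z}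

/-- `ι` is an involutive automorphism of the group `G`. -/
def IsInvolutiveAut (G : Type v) [Group G] (ι : G → G) : Prop :=
  Function.Bijective ι ∧ (∀ g h : G, ι (g * h) = ι g * ι h) ∧ (∀ g : G, ι (ι g) = g)

/-- `X` is isomorphic to the coset two-valued group `G/ι`: there is a quotient map
`π : G → X` whose fibres are exactly the `ι`-orbits and which carries the coset
two-valued multiplication `π g * π h = [π (g h), π (g ι(h))]`. -/
def IsCosetOf {T : Type u} {G : Type v} [Group G] (X : TwoValuedGroup T) (ι : G → G) : Prop :=
  ∃ π : G → T, Function.Surjective π ∧ π 1 = X.e ∧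
    (∀ g, π (ι g) = π g) ∧
    (∀ g h, π g = π h → h = g ∨ h = ι g) ∧
    (∀ g h, X.mul (π g) (π h) = {π (g * h), π (g * ι h)}) ∧
    (∀ g, X.inv (π g) = π g⁻¹)

/-- `X` is isomorphic to the coset two-valued group `X^a_A = A/ι_a`
for the antipodal involution `ι_a (a) = a⁻¹` of the abelian group `A`. -/
def IsAntipodalCosetOf {T : Type u} (X : TwoValuedGroup T) (A : Type v) [CommGroup A] : Prop :=
  ∃ π : A → T, Function.Surjective π ∧ π 1 = X.e ∧
    (∀ a, π a⁻¹ = π a) ∧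
    (∀ a b, π a = π b → b = a ∨ b = a⁻¹) ∧
    (∀ a b, X.mul (π a) (π b) = {π (a * b), π (a * b⁻¹)}) ∧
    (∀ a, X.inv (π a) = π a⁻¹)

/-- A Boolean group: every element squares to the identity. -/
def IsBooleanGroup (V : Type v) [CommGroup V] : Prop := ∀ x : V, x * x = 1

/-- For a Boolean group, `dim V ≥ 2` (as an `𝔽₂`-vector space) is equivalent to the
existence of two distinct nontrivial elements. -/
def BoolDimGE2 (V : Type v) [CommGroup V] : Prop := ∃ a b : V, a ≠ 1 ∧ b ≠ 1 ∧ a ≠ b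

/-- For a Boolean group, `dim V ≥ 3` is equivalent to the existence of three
linearly independent elements. -/
def BoolDimGE3 (V : Type v) [CommGroup V] : Prop :=
  ∃ a b c : V, a ≠ 1 ∧ b ≠ 1 ∧ a ≠ b ∧ c ≠ 1 ∧ c ≠ a ∧ c ≠ b ∧ c ≠ a * b

/-- Isomorphism of (single-valued) groups. -/
def GroupIsomorphic (A : Type v) (B : Type w) [CommGroup A] [CommGroup B] : Prop :=
  Nonempty (A ≃* B)

/-- `X` is isomorphic to the coset two-valued group `X^u_V = (V × V)/ι_u`,
where `ι_u (a, b) = (a, a b)` is the unipotent involution of the Boolean group `V × V`. -/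
def IsUnipotentCosetOf {T : Type u} (X : TwoValuedGroup T) (V : Type v) [CommGroup V] : Prop :=
  ∃ π : V × V → T, Function.Surjective π ∧ π (1, 1) = X.e ∧
    (∀ a b : V, π (a, a * b) = π (a, b)) ∧
    (∀ p q : V × V, π p = π q → q = p ∨ q = (p.1, p.1 * p.2)) ∧
    (∀ a₁ b₁ a₂ b₂ : V,
      X.mul (π (a₁, b₁)) (π (a₂, b₂)) = {π (a₁ * a₂, b₁ * b₂), π (a₁ * a₂, a₂ * b₁ * b₂)}) ∧
    (∀ p : V × V, X.inv (π p) = π p)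

/-- `X` is isomorphic to the direct product `X^u_V × W` of the unipotent coset
two-valued group `X^u_V = (V × V)/ι_u` and the Boolean group `W`. -/
def IsUnipotentCosetProdOf {T : Type u} (X : TwoValuedGroup T) (V : Type v) (W : Type w)
    [CommGroup V] [CommGroup W] : Prop :=
  ∃ f : (V × V) × W → T, Function.Surjective f ∧ f ((1, 1), 1) = X.e ∧
    (∀ (a b : V) (w : W), f ((a, a * b), w) = f ((a, b), w)) ∧
    (∀ p q : (V × V) × W, f p = f q → q.2 = p.2 ∧ (q.1 = p.1 ∨ q.1 = (p.1.1, p.1.1 * p.1.2))) ∧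
    (∀ (a₁ b₁ a₂ b₂ : V) (w₁ w₂ : W),
      X.mul (f ((a₁, b₁), w₁)) (f ((a₂, b₂), w₂)) =
        {f ((a₁ * a₂, b₁ * b₂), w₁ * w₂), f ((a₁ * a₂, a₂ * b₁ * b₂), w₁ * w₂)}) ∧
    (∀ p, X.inv (f p) = f p)

open Classical in
/-- The multiplication table of the special two-valued group `Y_V` on `Option V`:
`none` is the extra element `s`, `some v` are the elements of the Boolean group `V`. -/
noncomputable def mulY {V : Type v} [CommGroup V] : Option V → Option V → Multiset (Option V)
  | some x, some y =>
      if x = y then (if x = 1 then {some 1, some 1} else {some 1, none})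
      else {some (x * y), some (x * y)}
  | some x, none => if x = 1 then {none, none} else {some x, some x}
  | none, some y => if y = 1 then {none, none} else {some y, some y}
  | none, none => {some 1, some 1}

/-- `X` is isomorphic to the special two-valued group `Y_V`. -/
def IsYOf {T : Type u} (X : TwoValuedGroup T) (V : Type v) [CommGroup V] : Prop :=
  ∃ f : Option V → T, Function.Bijective f ∧ f (some 1) = X.e ∧
    (∀ uu vv : Option V, X.mul (f uu) (f vv) = (mulY uu vv).map f) ∧
    (∀ uu : Option V, X.inv (f uu) = f uu)

/-- `X` is isomorphic to the direct product `Y_V × W`. -/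
def IsYProdOf {T : Type u} (X : TwoValuedGroup T) (V : Type v) (W : Type w)
    [CommGroup V] [CommGroup W] : Prop :=
  ∃ f : Option V × W → T, Function.Bijective f ∧ f (some 1, 1) = X.e ∧
    (∀ (uu vv : Option V) (w₁ w₂ : W),
      X.mul (f (uu, w₁)) (f (vv, w₂)) = (mulY uu vv).map (fun z => f (z, w₁ * w₂))) ∧
    (∀ p : Option V × W, X.inv (f p) = f p)

/-- `X` is isomorphic to the direct product `X' × W` of the two-valued group `X'`
and the (single-valued) Boolean group `W`. -/
def IsDirectProdOf {T : Type u} {T' : Type v} (W : Type w) [CommGroup W]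
    (X : TwoValuedGroup T) (X' : TwoValuedGroup T') : Prop :=
  ∃ f : T' × W → T, Function.Bijective f ∧ f (X'.e, 1) = X.e ∧
    (∀ (x₁ x₂ : T') (w₁ w₂ : W),
      X.mul (f (x₁, w₁)) (f (x₂, w₂)) = (X'.mul x₁ x₂).map (fun z => f (z, w₁ * w₂))) ∧
    (∀ (x : T') (w : W), X.inv (f (x, w)) = f (X'.inv x, w))

/-- `X` contains a single-valued direct factor: `X ≅ X' × W` with `W` a nontrivial
Boolean group. -/
def HasSingleValuedDirectFactor {T : Type u} (X : TwoValuedGroup T) : Prop :=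
  ∃ (T' : Type u) (X' : TwoValuedGroup T') (W : Type u) (iW : CommGroup W),
    X'.Commutative ∧ X'.Involutive ∧ @IsBooleanGroup W iW ∧ Nontrivial W ∧
    @IsDirectProdOf T T' W iW X X'

/-- The Boolean group `C₂ⁿ`. -/
abbrev C2vec (n : ℕ) : Type := Fin n → Multiplicative (ZMod 2)

/-- The group `C₄ⁿ`. -/
abbrev C4vec (n : ℕ) : Type := Fin n → Multiplicative (ZMod 4)

end TwoValuedGroup

namespace TwoValuedGroup

/-- The members of a two-element multiset of the form `{z, z}` coincide. -/
theorem eq_of_pair_eq_pair_self {T : Type u} {p q z : T}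
    (h : ({p, q} : Multiset T) = {z, z}) : p = q := by
  have hp : p ∈ ({z, z} : Multiset T) := h ▸ by simp
  have hq : q ∈ ({z, z} : Multiset T) := h ▸ by simp
  simp only [Multiset.insert_eq_cons, Multiset.mem_cons, Multiset.mem_singleton, or_self] at hp hq
  rw [hp, hq]

/-- An element has order greater than `2` exactly when its square is not `{e, e}`. -/
theorem ordGT2_iff {T : Type u} {X : TwoValuedGroup T} {P : T → ℤ → T}
    (hP : X.IsPowFamily P) (x : T) : X.OrdGT2 P x ↔ X.mul x x ≠ {X.e, X.e} := by
  obtain ⟨h0, h1, -, hs⟩ := hP x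
  have hsq : X.mul x x = {X.e, P x 2} := by
    have := hs 1 le_rfl
    norm_num at this
    rwa [h0, h1] at this
  constructor
  · intro h heq
    have h2 : P x 2 = X.e := (eq_of_pair_eq_pair_self (hsq.symm.trans heq)).symm
    have hmem : 2 ∈ {n : ℕ | 0 < n ∧ P x (n : ℤ) = X.e} := ⟨two_pos, h2⟩
    have hpos := (Nat.sInf_mem ⟨2, hmem⟩).1
    have hle := Nat.sInf_le hmem
    unfold OrdGT2 ordOf at h
    omega
  · intro h
    by_contra hn
    unfold OrdGT2 at hn
    have hord : X.ordOf P x = 1 ∨ X.ordOf P x = 2 := by omega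
    have hmem : P x (X.ordOf P x : ℤ) = X.e :=
      (Nat.sInf_mem (Nat.nonempty_of_pos_sInf
        (show 0 < X.ordOf P x by omega))).2
    rcases hord with ho | ho
    · rw [ho, Nat.cast_one, h1] at hmem
      exact h (by rw [hmem, X.e_mul])
    · rw [ho, Nat.cast_ofNat] at hmem
      exact h (by rw [hsq, hmem])

/-- The antipodal coset two-valued groups are non-special. -/
theorem IsAntipodalCosetOf.not_isSpecial {T : Type u} {X : TwoValuedGroup T} {P : T → ℤ → T}
    (hP : X.IsPowFamily P) {A : Type v} [CommGroup A] (hX : X.IsAntipodalCosetOf A) :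
    ¬ X.IsSpecial P := by
  obtain ⟨π, hsurj, hone, -, hfib, hmul, -⟩ := hX
  rintro ⟨x, y, z, hx, hy, hxy⟩
  obtain ⟨a, rfl⟩ := hsurj x
  obtain ⟨b, rfl⟩ := hsurj y
  have hsq : ∀ c : A, c * c = 1 → X.mul (π c) (π c) = {X.e, X.e} := fun c hc => by
    rw [hmul, hc, mul_inv_cancel, hone]
  rw [ordGT2_iff hP] at hx hy
  rw [hmul] at hxy
  rcases hfib _ _ (eq_of_pair_eq_pair_self hxy) with h | h
  · refine hy (hsq b ?_)
    have hb : b⁻¹ = b := mul_left_cancel h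
    rw [← inv_mul_cancel b, hb]
  · refine hx (hsq a ?_)
    rw [mul_inv] at h
    have ha : a = a⁻¹ := mul_right_cancel h
    rw [← mul_inv_cancel a, ← ha]

/-- The products of unipotent coset two-valued groups with Boolean groups are non-special. -/
theorem IsUnipotentCosetProdOf.not_isSpecial {T : Type u} {X : TwoValuedGroup T} {P : T → ℤ → T}
    (hP : X.IsPowFamily P) {V : Type v} {W : Type w} [CommGroup V] [CommGroup W]
    (hV : IsBooleanGroup V) (hW : IsBooleanGroup W) (hX : X.IsUnipotentCosetProdOf V W) :
    ¬ X.IsSpecial P := by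
  obtain ⟨f, hsurj, hone, -, hfib, hmul, -⟩ := hX
  rintro ⟨x, y, z, hx, hy, hxy⟩
  obtain ⟨⟨⟨a₁, b₁⟩, w₁⟩, rfl⟩ := hsurj x
  obtain ⟨⟨⟨a₂, b₂⟩, w₂⟩, rfl⟩ := hsurj y
  have hsq : ∀ (b : V) (w : W), X.mul (f ((1, b), w)) (f ((1, b), w)) = {X.e, X.e} :=
    fun b w => by rw [hmul, one_mul, one_mul, hV b, hW w, hone]
  rw [ordGT2_iff hP] at hx hy
  rw [hmul] at hxy
  rcases (hfib _ _ (eq_of_pair_eq_pair_self hxy)).2 with h | h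
  · have ha : a₂ = 1 := by simpa [mul_assoc] using h
    subst ha
    exact hy (hsq b₂ w₂)
  · have ha : a₁ = 1 := by simpa [mul_assoc] using h
    subst ha
    exact hx (hsq b₁ w₁)

/-- The two-valued groups `Y_V × W` are special whenever `dim V ≥ 2`. -/
theorem IsYProdOf.isSpecial {T : Type u} {X : TwoValuedGroup T} {P : T → ℤ → T}
    (hP : X.IsPowFamily P) {V : Type v} {W : Type w} [CommGroup V] [CommGroup W]
    (hV : BoolDimGE2 V) (hX : X.IsYProdOf V W) : X.IsSpecial P := by
  obtain ⟨f, hbij, hone, hmul, -⟩ := hX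
  obtain ⟨a, b, ha, hb, hab⟩ := hV
  have hord : ∀ c : V, c ≠ 1 → X.OrdGT2 P (f (some c, 1)) := by
    intro c hc
    rw [ordGT2_iff hP]
    intro h
    rw [hmul] at h
    simp only [mulY, hc, if_true, if_false, Multiset.insert_eq_cons, Multiset.map_cons,
      Multiset.map_singleton] at h
    simpa using hbij.injective (eq_of_pair_eq_pair_self h)
  refine ⟨f (some a, 1), f (some b, 1), f (some (a * b), 1), hord a ha, hord b hb, ?_⟩
  rw [hmul]
  simp [mulY, hab]

/-- **Proposition 4.2 (propos_special_yn).** All two-valued groups of the form `X^a_A`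
(`A` abelian) and `X^u_V × W` (`V`, `W` Boolean) are non-special; the two-valued groups
`Y_V × W` are special whenever `dim V ≥ 2`. Here `X` is an involutive commutative
two-valued group with power family `P`. -/
theorem speciality_of_series {T : Type u} (X : TwoValuedGroup T)
    (hc : X.Commutative) (hinv : X.Involutive)
    (P : T → ℤ → T) (hP : X.IsPowFamily P) :
    (∀ (A : Type v) (iA : CommGroup A),
      @IsAntipodalCosetOf T X A iA → ¬ X.IsSpecial P) ∧
    (∀ (V : Type v) (W : Type w) (iV : CommGroup V) (iW : CommGroup W),
      @IsBooleanGroup V iV → @IsBooleanGroup W iW →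
      @IsUnipotentCosetProdOf T X V W iV iW → ¬ X.IsSpecial P) ∧
    (∀ (V : Type v) (W : Type w) (iV : CommGroup V) (iW : CommGroup W),
      @IsBooleanGroup V iV → @IsBooleanGroup W iW → @BoolDimGE2 V iV →
      @IsYProdOf T X V W iV iW → X.IsSpecial P) := by
  exact ⟨fun _ _ hX => hX.not_isSpecial hP,
    fun _ _ _ _ hV hW hX => hX.not_isSpecial hP hV hW,
    fun _ _ _ _ _ _ hV hX => hX.isSpecial hP hV⟩

end TwoValuedGroup
end

section
/- A finitely generated involutive commutative two-valued group X does not contain a single-valued direct factor if and only if every element v ∈ X of order 2 is the square of some element of X (i.e. v = x² for some x ∈ X). -/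
/-!
Two-valued groups after V.M. Buchstaber, A.P. Veselov and A.A. Gaifullin.

`X.mul x y` is the two-element multiset `x * y`.
-/

universe u v w u' v' w'

namespace TwoValuedGroup

/-- The multiplication of a two-valued group extended bilinearly to multisets. -/
def msMul {T : Type u} (X : TwoValuedGroup T) (A B : Multiset T) : Multiset T :=
  A.bind fun a => B.bind fun b => X.mul a b

theorem msMul_comm {T : Type u} {X : TwoValuedGroup T} (hc : X.Commutative)
    (A B : Multiset T) : X.msMul A B = X.msMul B A := by
  unfold msMul
  rw [Multiset.bind_bind]
  exact Multiset.bind_congr fun b _ => Multiset.bind_congr fun a _ => hc a b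

theorem msMul_assoc {T : Type u} (X : TwoValuedGroup T) (A B C : Multiset T) :
    X.msMul (X.msMul A B) C = X.msMul A (X.msMul B C) := by
  unfold msMul
  simp only [Multiset.bind_assoc]
  refine Multiset.bind_congr fun a _ => Multiset.bind_congr fun b _ => ?_
  rw [Multiset.bind_bind]
  exact Multiset.bind_congr fun c _ => X.assoc a b c

theorem msMul_singleton {T : Type u} (X : TwoValuedGroup T) (x y : T) :
    X.msMul {x} {y} = X.mul x y := by
  simp [msMul]

theorem msMul_pair {T : Type u} (X : TwoValuedGroup T) (a b c d : T) :
    X.msMul {a, b} {c, d} = X.mul a c + X.mul a d + (X.mul b c + X.mul b d) := by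
  simp only [msMul, Multiset.insert_eq_cons, Multiset.cons_bind, Multiset.singleton_bind]

theorem exists_mul_eq_pair {T : Type u} (X : TwoValuedGroup T) (x y : T) :
    ∃ a b, X.mul x y = {a, b} :=
  Multiset.card_eq_two.1 (X.card_mul x y)

theorem mem_mul_assoc {T : Type u} (X : TwoValuedGroup T) {x y z t w : T}
    (ht : t ∈ X.mul x y) (hw : w ∈ X.mul t z) : ∃ u ∈ X.mul y z, w ∈ X.mul x u := by
  have h : w ∈ (X.mul x y).bind fun t => X.mul t z := Multiset.mem_bind.2 ⟨t, ht, hw⟩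
  rw [X.assoc] at h
  exact Multiset.mem_bind.1 h

theorem mem_mul_assoc_symm {T : Type u} (X : TwoValuedGroup T) {x y z t w : T}
    (ht : t ∈ X.mul y z) (hw : w ∈ X.mul x t) : ∃ u ∈ X.mul x y, w ∈ X.mul u z := by
  have h : w ∈ (X.mul y z).bind fun t => X.mul x t := Multiset.mem_bind.2 ⟨t, ht, hw⟩
  rw [← X.assoc] at h
  exact Multiset.mem_bind.1 h

theorem e_mem_mul_self {T : Type u} {X : TwoValuedGroup T} (hinv : X.Involutive) (x : T) :
    X.e ∈ X.mul x x := by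
  simpa [hinv x] using X.e_mem_mul_inv x

theorem eq_of_e_mem_mul {T : Type u} {X : TwoValuedGroup T} (hinv : X.Involutive) {x y : T}
    (h : X.e ∈ X.mul x y) : y = x := by
  simpa [hinv x] using X.inv_unique x y (Or.inl h)

theorem mem_mul_rotate {T : Type u} {X : TwoValuedGroup T} (hinv : X.Involutive) {x y z : T}
    (h : z ∈ X.mul x y) : x ∈ X.mul y z := by
  obtain ⟨t, ht, he⟩ := X.mem_mul_assoc h (e_mem_mul_self hinv z)
  rwa [eq_of_e_mem_mul hinv he] at ht

namespace IsPowFamily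

variable {T : Type u} {X : TwoValuedGroup T} {P : T → ℤ → T}

theorem mul_self (hP : X.IsPowFamily P) (x : T) : X.mul x x = {X.e, P x 2} := by
  obtain ⟨h0, h1, -, h⟩ := hP x
  simpa [h0, h1] using h 1 le_rfl

theorem mul_sq (hP : X.IsPowFamily P) (x : T) : X.mul x (P x 2) = {x, P x 3} := by
  obtain ⟨-, h1, -, h⟩ := hP x
  simpa [h1] using h 2 (by norm_num)

theorem mul_cube (hP : X.IsPowFamily P) (x : T) : X.mul x (P x 3) = {P x 2, P x 4} := by
  obtain ⟨-, -, -, h⟩ := hP x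
  simpa using h 3 (by norm_num)

theorem sq_sq (hP : X.IsPowFamily P) (x : T) : P (P x 2) 2 = P x 4 := by
  have h := X.assoc x x (P x 2)
  simp only [hP.mul_self, hP.mul_sq, hP.mul_cube, X.e_mul, Multiset.insert_eq_cons,
    Multiset.cons_bind, Multiset.singleton_bind] at h
  have h1 : ({P x 2, P x 2, X.e} : Multiset T) + {P (P x 2) 2}
      = {P x 2, P x 2, X.e} + {P x 4} := by
    simp only [Multiset.insert_eq_cons, ← Multiset.singleton_add] at h ⊢
    calc _ = _ := by abel
      _ = _ := h
      _ = _ := by abel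
  simpa using h1

theorem sq_e (hP : X.IsPowFamily P) : P X.e 2 = X.e := by
  have h := hP.mul_self X.e
  rw [X.e_mul] at h
  simpa [Multiset.insert_eq_cons] using h.symm

/-- Expanding `(x * y) * (x * y) = (x * x) * (y * y)`. -/
theorem mul_mul_self_expansion (hP : X.IsPowFamily P) (hc : X.Commutative) {x y z₁ z₂ : T}
    (h : X.mul x y = {z₁, z₂}) :
    2 • ({P x 2} + {P y 2}) + X.mul (P x 2) (P y 2)
      = {P z₁ 2} + {P z₂ 2} + 2 • X.mul z₁ z₂ := by
  have key : X.msMul (X.mul x x) (X.mul y y) = X.msMul (X.mul x y) (X.mul x y) := by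
    simp only [← msMul_singleton]
    rw [msMul_assoc, msMul_assoc, ← msMul_assoc X {x} {y} {y}, ← msMul_assoc X {y} {x} {y},
      msMul_comm hc {y} {x}]
  rw [h, hP.mul_self, hP.mul_self, msMul_pair, msMul_pair, X.e_mul, X.e_mul, X.mul_e,
    hP.mul_self, hP.mul_self, hc z₂ z₁] at key
  have h1 : ({X.e, X.e} : Multiset T) + (2 • ({P x 2} + {P y 2}) + X.mul (P x 2) (P y 2))
      = {X.e, X.e} + ({P z₁ 2} + {P z₂ 2} + 2 • X.mul z₁ z₂) := by
    simp only [Multiset.insert_eq_cons, ← Multiset.singleton_add] at key ⊢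
    calc _ = _ := by abel
      _ = _ := key
      _ = _ := by abel
  exact add_left_cancel h1

/-- If `x * y = [z₁, z₂]` and `z₁² = x²`, then both elements of `z₁ * z₂` are squares. -/
theorem isSquare_of_mem_mul (hP : X.IsPowFamily P) (hc : X.Commutative)
    (hinv : X.Involutive) {x y z₁ z₂ r : T} (h₁ : z₁ ∈ X.mul x y) (h₂ : z₂ ∈ X.mul x y)
    (hx : P z₁ 2 = P x 2) (hr : r ∈ X.mul z₁ z₂) : ∃ w, P w 2 = r := by
  have hy : y ∈ X.mul z₁ x := mem_mul_rotate hinv (mem_mul_rotate hinv h₁)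
  rw [hc x y] at h₂
  obtain ⟨u, hu, hz⟩ := X.mem_mul_assoc hy h₂
  have hz₂ : z₂ = z₁ ∨ z₂ = P z₁ 3 := by
    rw [hP.mul_self, ← hx] at hu
    simp only [Multiset.insert_eq_cons, Multiset.mem_cons, Multiset.mem_singleton] at hu
    rcases hu with rfl | rfl
    · rw [X.mul_e] at hz
      exact Or.inl (by simpa [Multiset.insert_eq_cons] using hz)
    · rw [hP.mul_sq] at hz
      simpa [Multiset.insert_eq_cons] using hz
  rcases hz₂ with rfl | rfl
  · rw [hP.mul_self] at hr
    simp only [Multiset.insert_eq_cons, Multiset.mem_cons, Multiset.mem_singleton] at hr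
    rcases hr with rfl | rfl
    exacts [⟨X.e, hP.sq_e⟩, ⟨z₂, rfl⟩]
  · rw [hP.mul_cube] at hr
    simp only [Multiset.insert_eq_cons, Multiset.mem_cons, Multiset.mem_singleton] at hr
    rcases hr with rfl | rfl
    exacts [⟨z₁, rfl⟩, ⟨P z₁ 2, hP.sq_sq z₁⟩]

/-- The squares form a subgroup. -/
theorem isSubgroup_squares (hP : X.IsPowFamily P) (hc : X.Commutative)
    (hinv : X.Involutive) : X.IsSubgroup (Set.range fun x => P x 2) := by
  classical
  rintro _ ⟨x, rfl⟩ _ ⟨y, rfl⟩ r hr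
  obtain ⟨z₁, z₂, hz⟩ := X.exists_mul_eq_pair x y
  obtain ⟨p, q, hpq⟩ := X.exists_mul_eq_pair z₁ z₂
  obtain ⟨s, hs⟩ : ∃ s, X.mul (P x 2) (P y 2) = {r, s} := by
    obtain ⟨t, ht⟩ := Multiset.exists_cons_of_mem hr
    obtain ⟨s, rfl⟩ : ∃ s, t = {s} := by
      have := X.card_mul (P x 2) (P y 2)
      rw [ht, Multiset.card_cons] at this
      exact Multiset.card_eq_one.1 (by omega)
    exact ⟨s, ht⟩
  have key := hP.mul_mul_self_expansion hc hz
  by_cases h₁ : P z₁ 2 = r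
  · exact ⟨z₁, h₁⟩
  by_cases h₂ : P z₂ 2 = r
  · exact ⟨z₂, h₂⟩
  rw [hs, hpq] at key
  have hcount : ∀ w, 2 * ((if w = P x 2 then 1 else 0) + (if w = P y 2 then 1 else 0))
      + ((if w = r then 1 else 0) + (if w = s then 1 else 0))
      = (if w = P z₁ 2 then 1 else 0) + (if w = P z₂ 2 then 1 else 0)
      + 2 * ((if w = p then 1 else 0) + (if w = q then 1 else 0)) := by
    intro w
    have := congrArg (Multiset.count w) key
    simp only [Multiset.insert_eq_cons, ← Multiset.singleton_add, Multiset.count_add,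
      Multiset.count_nsmul, Multiset.count_singleton] at this
    simpa using this
  have hrs : s = r := by
    have := hcount r
    rw [if_neg (Ne.symm h₁), if_neg (Ne.symm h₂), if_pos rfl] at this
    by_contra hne
    rw [if_neg (Ne.symm hne)] at this
    omega
  subst hrs
  have hzz : P z₂ 2 = P z₁ 2 := by
    have := hcount (P z₁ 2)
    rw [if_pos rfl, if_neg h₁] at this
    by_contra hne
    rw [if_neg (Ne.symm hne)] at this
    omega
  have hmem : s ∈ X.mul z₁ z₂ := by
    have := hcount s
    rw [if_neg (Ne.symm h₁), if_neg (Ne.symm h₂), if_pos rfl] at this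
    rw [hpq]
    simp only [Multiset.insert_eq_cons, Multiset.mem_cons, Multiset.mem_singleton]
    by_contra! hne
    rw [if_neg hne.1, if_neg hne.2] at this
    omega
  have hz₁ : z₁ ∈ X.mul x y := by simp [hz, Multiset.insert_eq_cons]
  have hz₂ : z₂ ∈ X.mul x y := by simp [hz, Multiset.insert_eq_cons]
  by_cases hx : P z₁ 2 = P x 2
  · exact hP.isSquare_of_mem_mul hc hinv hz₁ hz₂ hx hmem
  · have hy : P z₁ 2 = P y 2 := by
      have := hcount (P z₁ 2)
      rw [if_pos rfl, if_neg h₁, if_neg hx, hzz, if_pos rfl] at this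
      by_contra hne
      rw [if_neg hne] at this
      omega
    rw [hc x y] at hz₁ hz₂
    exact hP.isSquare_of_mem_mul hc hinv hz₁ hz₂ hy hmem

theorem ordOf_eq_two_iff (hP : X.IsPowFamily P) (v : T) :
    X.ordOf P v = 2 ↔ v ≠ X.e ∧ P v 2 = X.e := by
  constructor
  · intro h
    have hne : {n : ℕ | 0 < n ∧ P v (n : ℤ) = X.e}.Nonempty :=
      Nat.nonempty_of_sInf_eq_succ h
    have hmem := Nat.sInf_mem hne
    rw [show sInf _ = 2 from h] at hmem
    refine ⟨fun hv => ?_, by simpa using hmem.2⟩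
    have : X.ordOf P v ≤ 1 := Nat.sInf_le ⟨one_pos, by simpa [(hP v).2.1] using hv⟩
    omega
  · rintro ⟨hv, h2⟩
    have h2' : 2 ∈ {n : ℕ | 0 < n ∧ P v (n : ℤ) = X.e} := ⟨two_pos, by simpa using h2⟩
    refine le_antisymm (Nat.sInf_le h2') (le_csInf ⟨2, h2'⟩ fun n hn => ?_)
    by_contra! hlt
    obtain rfl : n = 1 := by have := hn.1; omega
    exact hv (by simpa [(hP v).2.1] using hn.2)

end IsPowFamily

section Translation

variable {T : Type u} {X : TwoValuedGroup T}

/-- Multiplication by an element `v` with `v * v = [e, e]` is single-valued. -/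
theorem exists_translation {v : T} (hv : X.mul v v = {X.e, X.e}) :
    ∃ s : T → T, (∀ x, X.mul v x = {s x, s x}) ∧ (∀ x, s (s x) = x) ∧
      ∀ x y, X.mul (s x) y = (X.mul x y).map s := by
  have hvv : ∀ x t, t ∈ X.mul v x → X.mul v t = {x, x} := by
    intro x t ht
    obtain ⟨a, b, hab⟩ := X.exists_mul_eq_pair v t
    have hx : ∀ w ∈ X.mul v t, w = x := by
      intro w hw
      obtain ⟨u, hu, hw'⟩ := X.mem_mul_assoc_symm ht hw
      rw [hv] at hu
      obtain rfl : u = X.e := by simpa [Multiset.insert_eq_cons] using hu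
      rw [X.e_mul] at hw'
      simpa [Multiset.insert_eq_cons] using hw'
    rw [hab, hx a (by simp [hab, Multiset.insert_eq_cons]),
      hx b (by simp [hab, Multiset.insert_eq_cons])]
  have hex : ∀ x, ∃ t, X.mul v x = {t, t} := by
    intro x
    obtain ⟨a, b, hab⟩ := X.exists_mul_eq_pair v x
    have ha := hvv x a (by simp [hab, Multiset.insert_eq_cons])
    exact ⟨a, hvv a x (by simp [ha, Multiset.insert_eq_cons])⟩
  choose s hs using hex
  refine ⟨s, hs, fun x => ?_, fun x y => ?_⟩
  · have h := hvv x (s x) (by simp [hs, Multiset.insert_eq_cons])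
    have hm : s (s x) ∈ X.mul v (s x) := by simp [hs, Multiset.insert_eq_cons]
    rw [h] at hm
    simpa [Multiset.insert_eq_cons] using hm
  · have h := X.assoc v x y
    obtain ⟨a, b, hab⟩ := X.exists_mul_eq_pair x y
    simp only [hs, hab, Multiset.insert_eq_cons, Multiset.cons_bind,
      Multiset.singleton_bind] at h
    have h2 : 2 • X.mul (s x) y = 2 • ({s a} + {s b}) := by
      simp only [← Multiset.singleton_add] at h
      rw [two_nsmul, h]
      abel
    rw [hab]
    simpa [Multiset.insert_eq_cons, ← Multiset.singleton_add] using
      nsmul_right_injective two_ne_zero h2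

/-- The two-valued group structure on a subgroup of an involutive two-valued group. -/
def restrict (X : TwoValuedGroup T) (hinv : X.Involutive) (Y : Set T) (hY : X.IsSubgroup Y)
    (he : X.e ∈ Y) : TwoValuedGroup Y where
  mul x y := (X.mul x y).pmap Subtype.mk fun z hz => hY x x.2 y y.2 z hz
  e := ⟨X.e, he⟩
  inv := id
  card_mul x y := by simp [X.card_mul]
  assoc x y z := by
    apply Multiset.map_injective Subtype.val_injective
    simp only [Multiset.map_bind, Multiset.map_pmap, Multiset.pmap_eq_map, Multiset.map_id']
    have key : ∀ (a b : Y) (g : T → Multiset T),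
        ((X.mul a b).pmap Subtype.mk fun z hz => hY a a.2 b b.2 z hz).bind
          (fun t : Y => g t) = (X.mul a b).bind g := by
      intro a b g
      rw [← Multiset.bind_map _ g Subtype.val, Multiset.map_pmap, Multiset.pmap_eq_map,
        Multiset.map_id']
    rw [key x y fun t => X.mul t z, key y z fun t => X.mul x t, X.assoc]
  e_mul x := by
    apply Multiset.map_injective Subtype.val_injective
    rw [Multiset.map_pmap, Multiset.pmap_eq_map, Multiset.map_id', X.e_mul]
    rfl
  mul_e x := by
    apply Multiset.map_injective Subtype.val_injective
    rw [Multiset.map_pmap, Multiset.pmap_eq_map, Multiset.map_id', X.mul_e]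
    rfl
  e_mem_mul_inv x := by
    simpa [Multiset.mem_pmap] using e_mem_mul_self hinv (x : T)
  e_mem_inv_mul x := by
    simpa [Multiset.mem_pmap] using e_mem_mul_self hinv (x : T)
  inv_unique x y h := by
    simp only [Multiset.mem_pmap, Subtype.mk.injEq, exists_prop, exists_eq_right] at h
    exact Subtype.ext (h.elim (eq_of_e_mem_mul hinv) fun h => (eq_of_e_mem_mul hinv h).symm)

theorem map_val_restrict_mul (hinv : X.Involutive) {Y : Set T}
    (hY : X.IsSubgroup Y) (he : X.e ∈ Y) (x y : Y) :
    ((X.restrict hinv Y hY he).mul x y).map Subtype.val = X.mul x y := by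
  simp only [restrict, Multiset.map_pmap, Multiset.pmap_eq_map, Multiset.map_id']

/-- A subgroup meeting each orbit of a single-valued translation in exactly one point
splits off a single-valued direct factor. -/
theorem hasSingleValuedDirectFactor_of_translation (hc : X.Commutative)
    (hinv : X.Involutive) {s : T → T} (hss : ∀ x, s (s x) = x)
    (hs : ∀ x y, X.mul (s x) y = (X.mul x y).map s) {Y : Set T} (hY : X.IsSubgroup Y)
    (he : X.e ∈ Y) (hsY : ∀ x, s x ∈ Y ↔ x ∉ Y) : X.HasSingleValuedDirectFactor := by
  classical
  have hmap := map_val_restrict_mul hinv hY he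
  have hs' : ∀ x y, X.mul x (s y) = (X.mul x y).map s := fun x y => by
    rw [hc, hs, hc]
  have hone : (-1 : ℤˣ) ≠ 1 := by decide
  refine ⟨Y, X.restrict hinv Y hY he, ULift ℤˣ, inferInstance, ?_, fun _ => rfl, ?_,
    ⟨⟨1⟩, ⟨-1⟩, fun h => hone (congrArg ULift.down h).symm⟩, fun p => if p.2.down = 1 then p.1 else s p.1, ⟨?_, ?_⟩, ?_, ?_, ?_⟩
  · intro x y
    apply Multiset.map_injective Subtype.val_injective
    rw [hmap, hmap, hc]
  · exact fun w => ULift.ext _ _ (Int.units_mul_self w.down)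
  · rintro ⟨x, ⟨a⟩⟩ ⟨y, ⟨b⟩⟩ h
    have hx := (hsY x).not.2 (not_not.2 x.2)
    have hy := (hsY y).not.2 (not_not.2 y.2)
    rcases Int.units_eq_one_or a with rfl | rfl <;>
      rcases Int.units_eq_one_or b with rfl | rfl <;>
      simp only [hone, if_true, if_false] at h
    · rw [Subtype.ext h]
    · exact absurd (h ▸ x.2) hy
    · exact absurd (h ▸ y.2) hx
    · rw [Subtype.ext ((hss x).symm.trans ((congrArg s h).trans (hss y)))]
  · intro x
    by_cases hx : x ∈ Y
    · exact ⟨(⟨x, hx⟩, ⟨1⟩), by simp⟩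
    · exact ⟨(⟨s x, (hsY x).2 hx⟩, ⟨-1⟩), by simp [hone, hss]⟩
  · simp [restrict]
  · rintro x y ⟨a⟩ ⟨b⟩
    rcases Int.units_eq_one_or a with rfl | rfl <;>
      rcases Int.units_eq_one_or b with rfl | rfl <;>
      simp [hone, hs, hs', hss, ← hmap x y, Multiset.map_map]
  · intro x w
    simp [hinv _, restrict]

end Translation

section Maximal

variable {T : Type u} {X : TwoValuedGroup T} {P : T → ℤ → T}

/-- Adjoining one element to a subgroup that contains all squares. -/
theorem isSubgroup_adjoin (hc : X.Commutative) {Y : Set T} (hY : X.IsSubgroup Y) {x : T}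
    (hx : ∀ u ∈ X.mul x x, u ∈ Y) :
    X.IsSubgroup (Y ∪ {z | ∃ y ∈ Y, z ∈ X.mul y x}) := by
  have hmix : ∀ y₁ ∈ Y, ∀ z, (∃ y ∈ Y, z ∈ X.mul y x) → ∀ w ∈ X.mul y₁ z,
      ∃ y ∈ Y, w ∈ X.mul y x := by
    rintro y₁ hy₁ z ⟨y, hy, hz⟩ w hw
    obtain ⟨t, ht, hw⟩ := X.mem_mul_assoc_symm hz hw
    exact ⟨t, hY _ hy₁ _ hy _ ht, hw⟩
  rintro z₁ (h₁ | h₁) z₂ (h₂ | h₂) w hw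
  · exact Or.inl (hY _ h₁ _ h₂ _ hw)
  · exact Or.inr (hmix _ h₁ _ h₂ _ hw)
  · rw [hc] at hw
    exact Or.inr (hmix _ h₂ _ h₁ _ hw)
  · obtain ⟨y₁, hy₁, hz₁⟩ := h₁
    obtain ⟨y₂, hy₂, hz₂⟩ := h₂
    rw [hc] at hz₂
    obtain ⟨t, ht, hw⟩ := X.mem_mul_assoc_symm hz₂ hw
    obtain ⟨u, hu, ht⟩ := X.mem_mul_assoc hz₁ ht
    exact Or.inl (hY _ (hY _ hy₁ _ (hx u hu) _ ht) _ hy₂ _ hw)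

theorem exists_maximal_subgroup (hP : X.IsPowFamily P) (hc : X.Commutative)
    (hinv : X.Involutive) {v : T} (hv : ∀ x, P x 2 ≠ v) :
    ∃ Y : Set T, Maximal (fun Y => X.IsSubgroup Y ∧ (∀ x, P x 2 ∈ Y) ∧ v ∉ Y) Y := by
  have hub : ∀ C ⊆ {Y : Set T | X.IsSubgroup Y ∧ (∀ x, P x 2 ∈ Y) ∧ v ∉ Y},
      IsChain (· ⊆ ·) C → C.Nonempty →
      ∃ ub ∈ {Y : Set T | X.IsSubgroup Y ∧ (∀ x, P x 2 ∈ Y) ∧ v ∉ Y}, ∀ Y ∈ C, Y ⊆ ub := by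
    rintro C hC hchain ⟨Y₀, hY₀⟩
    refine ⟨⋃₀ C, ⟨?_, fun x => ⟨Y₀, hY₀, (hC hY₀).2.1 x⟩, ?_⟩,
      fun Y hY => Set.subset_sUnion_of_mem hY⟩
    · rintro y₁ ⟨Y₁, hY₁, h₁⟩ y₂ ⟨Y₂, hY₂, h₂⟩ z hz
      rcases hchain.total hY₁ hY₂ with h | h
      · exact ⟨Y₂, hY₂, (hC hY₂).1 _ (h h₁) _ h₂ _ hz⟩
      · exact ⟨Y₁, hY₁, (hC hY₁).1 _ h₁ _ (h h₂) _ hz⟩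
    · rintro ⟨Y, hY, hvY⟩
      exact (hC hY).2.2 hvY
  obtain ⟨Y, -, hY⟩ := zorn_subset_nonempty _ hub (Set.range fun x => P x 2)
    ⟨hP.isSubgroup_squares hc hinv, fun x => ⟨x, rfl⟩, fun ⟨x, hx⟩ => hv x hx⟩
  exact ⟨Y, hY⟩

theorem hasSingleValuedDirectFactor_of_not_square (hP : X.IsPowFamily P)
    (hc : X.Commutative) (hinv : X.Involutive) {v : T} (hv : P v 2 = X.e)
    (hsq : ∀ x, P x 2 ≠ v) : X.HasSingleValuedDirectFactor := by
  obtain ⟨s, hsv, hss, hs⟩ := exists_translation (X := X) (v := v) (by rw [hP.mul_self, hv])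
  obtain ⟨Y, ⟨hY, hYsq, hvY⟩, hmax⟩ := exists_maximal_subgroup hP hc hinv hsq
  have he : X.e ∈ Y := hP.sq_e ▸ hYsq X.e
  refine hasSingleValuedDirectFactor_of_translation hc hinv hss hs hY he fun x =>
    ⟨fun hsx hx => ?_, fun hx => ?_⟩
  · apply hvY
    refine hY _ hsx _ hx _ ?_
    have hve : s X.e = v := by
      have h := hsv X.e
      rw [X.mul_e] at h
      have hm : s X.e ∈ ({v, v} : Multiset T) := by simp [h, Multiset.insert_eq_cons]
      simpa [Multiset.insert_eq_cons] using hm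
    rw [hs, ← hve]
    exact Multiset.mem_map_of_mem s (e_mem_mul_self hinv x)
  · have hsub := isSubgroup_adjoin hc hY (x := x) (by
      intro u hu
      rw [hP.mul_self] at hu
      simp only [Multiset.insert_eq_cons, Multiset.mem_cons, Multiset.mem_singleton] at hu
      rcases hu with rfl | rfl
      exacts [he, hYsq x])
    have hvZ : v ∈ Y ∪ {z | ∃ y ∈ Y, z ∈ X.mul y x} := by
      by_contra hvZ
      refine hx (hmax ⟨hsub, fun z => Or.inl (hYsq z), hvZ⟩ Set.subset_union_left
        (Or.inr ⟨X.e, he, ?_⟩))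
      simp [X.e_mul, Multiset.insert_eq_cons]
    obtain ⟨y, hy, hvy⟩ := hvZ.resolve_left hvY
    have hxv : x ∈ X.mul v y := mem_mul_rotate hinv (mem_mul_rotate hinv hvy)
    rw [hsv] at hxv
    obtain rfl : x = s y := by simpa [Multiset.insert_eq_cons] using hxv
    rwa [hss]

end Maximal

/-- In a product `X' × W` the elements `(e, w)` with `w ≠ 1` have order two and are not
squares. -/
theorem HasSingleValuedDirectFactor.exists_not_square {T : Type u} {X : TwoValuedGroup T}
    {P : T → ℤ → T} (hP : X.IsPowFamily P) (h : X.HasSingleValuedDirectFactor) :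
    ∃ v, v ≠ X.e ∧ P v 2 = X.e ∧ ∀ x, P x 2 ≠ v := by
  obtain ⟨T', X', W, iW, -, -, hW, hnt, f, hf, hfe, hmul, -⟩ := h
  obtain ⟨w, hw⟩ := exists_ne (1 : W)
  refine ⟨f (X'.e, w), fun h => hw ?_, ?_, fun x hx => hw ?_⟩
  · rw [← hfe] at h
    exact (Prod.ext_iff.1 (hf.1 h)).2
  · have h := hmul X'.e X'.e w w
    rw [hP.mul_self, hW, X'.e_mul] at h
    simpa [Multiset.insert_eq_cons, hfe] using h
  · obtain ⟨⟨x', w'⟩, rfl⟩ := hf.2 x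
    have h := hmul x' x' w' w'
    rw [hP.mul_self, hW, hx] at h
    have hm : f (X'.e, w) ∈ (X'.mul x' x').map fun z => f (z, 1) := by
      rw [← h]
      simp [Multiset.insert_eq_cons]
    obtain ⟨z, -, hz⟩ := Multiset.mem_map.1 hm
    exact (Prod.ext_iff.1 (hf.1 hz)).2.symm

/-- **Proposition 6.1 (propos_neras).** A finitely generated involutive commutative
two-valued group contains no single-valued direct factor if and only if every element of
order `2` is the square of some element. Here `P` is the (unique) family of integer
power sequences, so squares are the elements `P x 2`. -/
theorem no_single_valued_factor_iff {T : Type u} (X : TwoValuedGroup T)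
    (hc : X.Commutative) (hinv : X.Involutive)
    (P : T → ℤ → T) (hP : X.IsPowFamily P)
    (hfg : X.FinitelyGenerated) :
    ¬ HasSingleValuedDirectFactor X ↔
      ∀ v : T, X.ordOf P v = 2 → ∃ x : T, P x 2 = v := by
  constructor
  · intro h v hv
    by_contra! hsq
    exact h (hasSingleValuedDirectFactor_of_not_square hP hc hinv
      ((hP.ordOf_eq_two_iff v).1 hv).2 hsq)
  · intro h hX
    obtain ⟨v, hv, hv2, hsq⟩ := hX.exists_not_square hP
    obtain ⟨x, hx⟩ := h v ((hP.ordOf_eq_two_iff v).2 ⟨hv, hv2⟩)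
    exact hsq x hx

end TwoValuedGroup
end

section
/- Let V and W be Boolean groups and let φ : V×V → W be an involutive symmetric cocycle, that is, a map satisfying φ(u,v)·φ(uv,w)·φ(u,vw)·φ(v,w) = e for all u,v,w ∈ V, together with φ(u,v) = φ(v,u) and φ(u,u) = φ(e,u) = φ(u,e) = e for all u,v ∈ V. Then φ is cohomologically trivial: there exists a map χ : V → W with χ(e) = e such that φ(u,v) = χ(u)·χ(v)·χ(uv) for all u,v ∈ V. -/
/-!
**Lemma 8.4 (lem_cocycle).** Every involutive symmetric 2-cocycle on a Boolean group `V`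
with values in a Boolean group `W` is cohomologically trivial.
-/

universe u v

/-- An injective homomorphism into a Boolean group has a left inverse. -/
theorem MonoidHom.exists_leftInverse_of_boolean {A B : Type*} [CommGroup A] [CommGroup B]
    (hB : ∀ b : B, b * b = 1) (f : A →* B) (hf : Function.Injective f) :
    ∃ g : B →* A, ∀ a, g (f a) = a := by
  have hA : ∀ a : A, a * a = 1 := fun a => hf (by rw [map_mul, hB, map_one])
  let : Module (ZMod 2) (Additive A) :=
    AddCommGroup.zmodModule fun a => (two_nsmul a).trans (hA a.toMul)
  let : Module (ZMod 2) (Additive B) :=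
    AddCommGroup.zmodModule fun b => (two_nsmul b).trans (hB b.toMul)
  obtain ⟨g, hg⟩ := (f.toAdditive.toZModLinearMap 2).exists_leftInverse_of_injective
    (LinearMap.ker_eq_bot.mpr hf)
  exact ⟨AddMonoidHom.toMultiplicative g.toAddMonoidHom, fun a => LinearMap.congr_fun hg a⟩

/-- The underlying set of the extension of `V` by `W` attached to a cocycle. -/
@[ext]
structure CocycleExtension {V W : Type*} (φ : V → V → W) where
  /-- The component in the base. -/
  base : V
  /-- The component in the fibre. -/
  fibre : W

/-- The extension of a Boolean group by a Boolean group attached to an involutive symmetric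
cocycle is a commutative group in which every element is its own inverse. -/
abbrev CocycleExtension.commGroup {V W : Type*} [CommGroup V] [CommGroup W]
    (hV : ∀ x : V, x * x = 1) (hW : ∀ y : W, y * y = 1) (φ : V → V → W)
    (hcoc : ∀ u v w : V, φ u v * φ (u * v) w * φ u (v * w) * φ v w = 1)
    (hsym : ∀ u v : V, φ u v = φ v u) (hdiag : ∀ u : V, φ u u = 1)
    (hone : ∀ u : V, φ 1 u = 1) : CommGroup (CocycleExtension φ) where
  mul x y := ⟨x.base * y.base, x.fibre * y.fibre * φ x.base y.base⟩
  one := ⟨1, 1⟩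
  inv x := x
  mul_assoc x y z := by
    obtain ⟨u, a⟩ := x
    obtain ⟨v, b⟩ := y
    obtain ⟨w, c⟩ := z
    have key : φ u v * φ (u * v) w = φ v w * φ u (v * w) := by
      have h := hcoc u v w
      rw [mul_assoc, mul_comm (φ u (v * w))] at h
      exact (eq_inv_of_mul_eq_one_left h).trans (inv_eq_of_mul_eq_one_left (hW _))
    refine CocycleExtension.ext (mul_assoc u v w) ?_
    change a * b * φ u v * c * φ (u * v) w = a * (b * c * φ v w) * φ u (v * w)
    calc _ = a * b * c * (φ u v * φ (u * v) w) := by ac_rfl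
      _ = _ := by rw [key]; ac_rfl
  one_mul x := CocycleExtension.ext (one_mul x.base) <| by
    change 1 * x.fibre * φ 1 x.base = x.fibre
    rw [hone, one_mul, mul_one]
  mul_one x := CocycleExtension.ext (mul_one x.base) <| by
    change x.fibre * 1 * φ x.base 1 = x.fibre
    rw [hsym, hone, mul_one, mul_one]
  inv_mul_cancel x := CocycleExtension.ext (hV x.base) <| by
    change x.fibre * x.fibre * φ x.base x.base = 1
    rw [hW, hdiag, mul_one]
  mul_comm x y := CocycleExtension.ext (mul_comm x.base y.base) <| by
    change x.fibre * y.fibre * φ x.base y.base = y.fibre * x.fibre * φ y.base x.base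
    rw [hsym, mul_comm x.fibre]

theorem involutive_symmetric_cocycle_trivial {V : Type u} {W : Type v}
    [CommGroup V] [CommGroup W]
    (hV : ∀ x : V, x * x = 1) (hW : ∀ y : W, y * y = 1)
    (φ : V → V → W)
    (hcoc : ∀ u v w : V, φ u v * φ (u * v) w * φ u (v * w) * φ v w = 1)
    (hsym : ∀ u v : V, φ u v = φ v u)
    (hdiag : ∀ u : V, φ u u = 1)
    (hone : ∀ u : V, φ 1 u = 1 ∧ φ u 1 = 1) :
    ∃ χ : V → W, χ 1 = 1 ∧ ∀ u v : V, φ u v = χ u * χ v * χ (u * v) := by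
  let := CocycleExtension.commGroup hV hW φ hcoc hsym hdiag fun u => (hone u).1
  have mul_def : ∀ (u v : V) (a b : W),
      (⟨u, a⟩ * ⟨v, b⟩ : CocycleExtension φ) = ⟨u * v, a * b * φ u v⟩ := fun _ _ _ _ => rfl
  let ι : W →* CocycleExtension φ :=
    { toFun := fun a => ⟨1, a⟩
      map_one' := rfl
      map_mul' := fun a b => by rw [mul_def, hdiag, mul_one, mul_one] }
  obtain ⟨r, hr⟩ := ι.exists_leftInverse_of_boolean (fun x => inv_mul_cancel x)
    fun a b h => congrArg CocycleExtension.fibre h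
  refine ⟨fun u => r ⟨u, 1⟩, map_one r, fun u v => ?_⟩
  have split : (⟨u, 1⟩ * ⟨v, 1⟩ : CocycleExtension φ) = ι (φ u v) * ⟨u * v, 1⟩ := by
    change _ = (⟨1, φ u v⟩ * ⟨u * v, 1⟩ : CocycleExtension φ)
    rw [mul_def, mul_def, (hone _).1]
    simp only [one_mul, mul_one]
  rw [← map_mul, split, map_mul, hr, mul_assoc, hW, mul_one]
end

section
/- Let X be an involutive two-valued group and x an arbitrary element of X. Then x^k * x^l = [x^{k+l}, x^{k−l}] and (x^k)^l = x^{kl} for all integers k and l. -/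
/-!
Two-valued groups after V.M. Buchstaber, A.P. Veselov and A.A. Gaifullin.

`X.mul x y` is the two-element multiset `x * y`.
-/

universe u v w u' v' w'

namespace TwoValuedGroup

/-- Powers of `x` commute with `x`. -/
theorem IsPowFamily.pow_mul_self {T : Type u} {X : TwoValuedGroup T} {P : T → ℤ → T}
    (hP : X.IsPowFamily P) (x : T) (n : ℕ) : X.mul (P x n) x = X.mul x (P x n) := by
  obtain ⟨h0, h1, -, hs⟩ := hP x
  induction n using Nat.twoStepInduction with
  | zero => simp [h0, X.e_mul, X.mul_e]
  | one => simp [h1]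
  | more n ih ih' =>
    have hmul := hs ((n + 1 : ℕ) : ℤ) (by push_cast; lia)
    have hassoc := X.assoc x (P x ((n + 1 : ℕ) : ℤ)) x
    rw [ih', hmul, show ((n + 1 : ℕ) : ℤ) - 1 = (n : ℤ) by push_cast; ring,
      show ((n + 1 : ℕ) : ℤ) + 1 = ((n + 2 : ℕ) : ℤ) by push_cast; ring] at hassoc
    simp only [Multiset.insert_eq_cons, Multiset.cons_bind, Multiset.singleton_bind, ih] at hassoc
    exact add_left_cancel hassoc

theorem IsPowFamily.pow_mul_self_eq {T : Type u} {X : TwoValuedGroup T} {P : T → ℤ → T}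
    (hP : X.IsPowFamily P) (x : T) (k : ℤ) : X.mul (P x k) x = {P x (k + 1), P x (k - 1)} := by
  have hcomm := hP.pow_mul_self x
  obtain ⟨h0, h1, hneg, hs⟩ := hP x
  have hnat (n : ℕ) : X.mul (P x n) x = {P x (n + 1), P x (n - 1)} := by
    rcases Nat.eq_zero_or_pos n with rfl | hn
    · simp [h0, h1, hneg, X.e_mul]
    · rw [hcomm, hs n (by exact_mod_cast hn), Multiset.pair_comm]
  obtain ⟨n, rfl | rfl⟩ := k.eq_nat_or_neg
  · exact hnat n
  · rw [hneg, hnat, Multiset.pair_comm, ← hneg (n + 1), ← hneg (n - 1)]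
    congr 3 <;> ring

theorem IsPowFamily.pow_mul_pow {T : Type u} {X : TwoValuedGroup T} {P : T → ℤ → T}
    (hP : X.IsPowFamily P) (x : T) (k l : ℤ) :
    X.mul (P x k) (P x l) = {P x (k + l), P x (k - l)} := by
  have hone := hP.pow_mul_self_eq x
  obtain ⟨h0, h1, hneg, hs⟩ := hP x
  have hnat (n : ℕ) : ∀ k : ℤ, X.mul (P x k) (P x n) = {P x (k + n), P x (k - n)} := by
    induction n using Nat.twoStepInduction with
    | zero => simp [h0, X.mul_e]
    | one => simpa [h1] using hone
    | more n ih ih' =>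
      intro k
      have hmul := hs ((n + 1 : ℕ) : ℤ) (by push_cast; lia)
      have hassoc := X.assoc (P x k) x (P x ((n + 1 : ℕ) : ℤ))
      rw [hone, hmul, show ((n + 1 : ℕ) : ℤ) - 1 = (n : ℤ) by push_cast; ring,
        show ((n + 1 : ℕ) : ℤ) + 1 = ((n + 2 : ℕ) : ℤ) by push_cast; ring] at hassoc
      simp only [Multiset.insert_eq_cons, Multiset.cons_bind, Multiset.singleton_bind, ih, ih']
        at hassoc
      rw [show k + 1 + ((n + 1 : ℕ) : ℤ) = k + ((n + 2 : ℕ) : ℤ) by push_cast; ring,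
        show k + 1 - ((n + 1 : ℕ) : ℤ) = k - n by push_cast; ring,
        show k - 1 + ((n + 1 : ℕ) : ℤ) = k + n by push_cast; ring,
        show k - 1 - ((n + 1 : ℕ) : ℤ) = k - ((n + 2 : ℕ) : ℤ) by push_cast; ring] at hassoc
      simp only [← Multiset.singleton_add] at hassoc
      simp only [Multiset.insert_eq_cons, ← Multiset.singleton_add]
      refine add_left_cancel (hassoc.symm.trans ?_)
      abel
  obtain ⟨n, rfl | rfl⟩ := l.eq_nat_or_neg
  · exact hnat n k
  · rw [hneg, hnat, Multiset.pair_comm, sub_neg_eq_add, sub_eq_add_neg]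

theorem IsPowFamily.pow_pow {T : Type u} {X : TwoValuedGroup T} {P : T → ℤ → T}
    (hP : X.IsPowFamily P) (x : T) (k l : ℤ) : P (P x k) l = P x (k * l) := by
  obtain ⟨h0, h1, hneg, hs⟩ := hP (P x k)
  have hneg' := (hP x).2.2.1
  have hnat (n : ℕ) : P (P x k) n = P x (k * n) := by
    induction n using Nat.twoStepInduction with
    | zero => simp [h0, (hP x).1]
    | one => simp [h1]
    | more n ih ih' =>
      have hmul := hs ((n + 1 : ℕ) : ℤ) (by push_cast; lia)
      rw [ih', hP.pow_mul_pow, show ((n + 1 : ℕ) : ℤ) - 1 = (n : ℤ) by push_cast; ring,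
        show ((n + 1 : ℕ) : ℤ) + 1 = ((n + 2 : ℕ) : ℤ) by push_cast; ring, ih,
        show k + k * ((n + 1 : ℕ) : ℤ) = k * ((n + 2 : ℕ) : ℤ) by push_cast; ring,
        show k - k * ((n + 1 : ℕ) : ℤ) = -(k * n) by push_cast; ring, hneg',
        Multiset.pair_comm] at hmul
      simpa [Multiset.insert_eq_cons] using hmul.symm
  obtain ⟨n, rfl | rfl⟩ := l.eq_nat_or_neg
  · exact hnat n
  · rw [hneg, hnat, mul_neg, hneg']

/-- **Lemma 2.4 (lem_sequence_mult).** In an involutive two-valued group,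
`x^k * x^l = [x^{k+l}, x^{k-l}]` and `(x^k)^l = x^{kl}` for all integers `k`, `l`.
Here `P` is the (unique) family of integer power sequences. -/
theorem pow_mul_pow_and_pow_pow {T : Type u} (X : TwoValuedGroup T) (hinv : X.Involutive)
    (P : T → ℤ → T) (hP : X.IsPowFamily P) (x : T) (k l : ℤ) :
    X.mul (P x k) (P x l) = {P x (k + l), P x (k - l)} ∧ P (P x k) l = P x (k * l) := by
  exact ⟨hP.pow_mul_pow x k l, hP.pow_pow x k l⟩

end TwoValuedGroup
end
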